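/- arXiv:2510.26185 — 2 statements merged into one kernel-verified Lean document; each statement's English description precedes it below -/
import Mathlib

section
/- Let Z be a finite set of indices of cardinality M ≥ 1, and for each z ∈ Z let L_z : EuclideanSpace ℝ (Fin p) → ℝ be twice continuously differentiable with gradient g_z and Hessian H_z (the Fréchet derivative of the gradient). Assume each Hessian is uniformly bounded, ‖H_z(θ)‖ ≤ Λ for all θ, and L-Lipschitz, ‖H_z(θ) − H_z(θ')‖ ≤ L‖θ − θ'‖. Fix a point θ, a vector e, an index k, constants G, Λ, L > 0 and a step size α > 0, and assume ‖e‖ ≤ (G/Λ) α. Define the ACC-SGD-IE residual R̃ := (1/M) Σ_{z∈Z} [ g_z(θ + e) − g_z(θ) − H_z(θ) e ] − (1/M)·(if k ∈ Z then H_k(θ) e else 0). Then ‖R̃‖ ≤ (G² L / (2Λ²)) α² + (Λ/M) ‖e‖. -/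
/-- First-order Taylor remainder estimate for a map whose derivative varies at most linearly with
constant `L` about `x`. -/
theorem norm_image_add_sub_sub_fderiv_le_of_lipschitz
    {E F : Type*} [NormedAddCommGroup E] [NormedSpace ℝ E]
    [NormedAddCommGroup F] [NormedSpace ℝ F]
    {f : E → F} {f' : E → E →L[ℝ] F} {L : ℝ}
    (hf : ∀ y, HasFDerivAt f (f' y) y) (x v : E)
    (hL : ∀ y, ‖f' y - f' x‖ ≤ L * ‖y - x‖) :
    ‖f (x + v) - f x - f' x v‖ ≤ L / 2 * ‖v‖ ^ 2 := by
  have hd : ∀ t : ℝ, HasDerivAt (fun t : ℝ => f (x + t • v) - f x - t • f' x v)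
      ((f' (x + t • v) - f' x) v) t := by
    intro t
    have hline : HasDerivAt (fun t : ℝ => x + t • v) v t := by
      simpa using ((hasDerivAt_id t).smul_const v).const_add x
    have hlin : HasDerivAt (fun t : ℝ => t • f' x v) (f' x v) t := by
      simpa using (hasDerivAt_id t).smul_const (f' x v)
    exact (((hf (x + t • v)).comp_hasDerivAt t hline).sub_const (f x)).sub hlin
  have hB : ∀ t : ℝ, HasDerivAt (fun t : ℝ => L / 2 * ‖v‖ ^ 2 * t ^ 2) (L * ‖v‖ ^ 2 * t) t := by
    intro t
    refine ((hasDerivAt_pow 2 t).const_mul (L / 2 * ‖v‖ ^ 2)).congr_deriv ?_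
    norm_num
    ring
  have key := image_norm_le_of_norm_deriv_right_le_deriv_boundary
    (a := 0) (b := 1) (fun t _ => (hd t).continuousAt.continuousWithinAt)
    (fun t _ => (hd t).hasDerivWithinAt) (by simp) hB
    (fun t ht => by
      calc ‖(f' (x + t • v) - f' x) v‖ ≤ ‖f' (x + t • v) - f' x‖ * ‖v‖ :=
            ContinuousLinearMap.le_opNorm _ _
        _ ≤ L * ‖x + t • v - x‖ * ‖v‖ := by gcongr; exact hL _
        _ = L * ‖v‖ ^ 2 * t := by
            rw [add_sub_cancel_left, norm_smul, Real.norm_of_nonneg ht.1]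
            ring)
    (Set.right_mem_Icc.2 zero_le_one)
  simpa using key

/-- Residual bound under non-convexity for the ACC-SGD-IE residual
`R̃ = (1/M) Σ_{z∈Z} [g_z(θ+e) − g_z(θ) − H_z(θ) e] − (1/M)(if k ∈ Z then H_k(θ) e else 0)`:
`‖R̃‖ ≤ (G²L/(2Λ²)) α² + (Λ/M)‖e‖` whenever `‖e‖ ≤ (G/Λ) α`. -/
theorem acc_sgd_ie_residual_bound {p : ℕ} {ι : Type*} [DecidableEq ι]
    (Z : Finset ι) (k : ι)
    (Lz : ι → EuclideanSpace ℝ (Fin p) → ℝ)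
    (Hz : ι → EuclideanSpace ℝ (Fin p) →
      (EuclideanSpace ℝ (Fin p) →L[ℝ] EuclideanSpace ℝ (Fin p)))
    (G Lam L α : ℝ)
    (θ e : EuclideanSpace ℝ (Fin p))
    (hM : 1 ≤ Z.card)
    (hC2 : ∀ z, ContDiff ℝ 2 (Lz z))
    (hHz : ∀ z θ', HasFDerivAt (fun x => gradient (Lz z) x) (Hz z θ') θ')
    (hbound : ∀ z θ', ‖Hz z θ'‖ ≤ Lam)
    (hLip : ∀ z θ₁ θ₂, ‖Hz z θ₁ - Hz z θ₂‖ ≤ L * ‖θ₁ - θ₂‖)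
    (hG : 0 < G) (hLam : 0 < Lam) (hL : 0 < L) (hα : 0 < α)
    (he : ‖e‖ ≤ (G / Lam) * α) :
    ‖((Z.card : ℝ))⁻¹ •
        (∑ z ∈ Z, (gradient (Lz z) (θ + e) - gradient (Lz z) θ - Hz z θ e)) -
      ((Z.card : ℝ))⁻¹ • (if k ∈ Z then Hz k θ e else 0)‖ ≤
      (G ^ 2 * L / (2 * Lam ^ 2)) * α ^ 2 + (Lam / (Z.card : ℝ)) * ‖e‖ := by
  have hMpos : (0 : ℝ) < Z.card := by exact_mod_cast hM
  have hterm : ∀ z ∈ Z, ‖gradient (Lz z) (θ + e) - gradient (Lz z) θ - Hz z θ e‖ ≤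
      G ^ 2 * L / (2 * Lam ^ 2) * α ^ 2 := by
    intro z _
    calc ‖gradient (Lz z) (θ + e) - gradient (Lz z) θ - Hz z θ e‖ ≤ L / 2 * ‖e‖ ^ 2 :=
          norm_image_add_sub_sub_fderiv_le_of_lipschitz (hHz z) θ e fun y => hLip z y θ
      _ ≤ L / 2 * (G / Lam * α) ^ 2 := by gcongr
      _ = G ^ 2 * L / (2 * Lam ^ 2) * α ^ 2 := by field_simp
  have hsum := norm_sum_le_of_le Z hterm
  rw [Finset.sum_const, nsmul_eq_mul] at hsum
  have hk : ‖if k ∈ Z then Hz k θ e else 0‖ ≤ Lam * ‖e‖ := by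
    split_ifs
    · exact (Hz k θ).le_of_opNorm_le (hbound k θ) e
    · rw [norm_zero]
      positivity
  refine (norm_sub_le _ _).trans (add_le_add ?_ ?_)
  · rw [norm_smul, Real.norm_of_nonneg (by positivity), inv_mul_le_iff₀ hMpos]
    exact hsum
  · rw [norm_smul, Real.norm_of_nonneg (by positivity), inv_mul_le_iff₀ hMpos]
    refine hk.trans_eq ?_
    field_simp
end

section
/- Let α, λ, L > 0 with α λ ≤ 1, let i₀ ∈ ℕ, and let (δ_i) be a sequence of nonnegative reals satisfying δ_{i+1} ≤ (1 − (3/4) α λ) δ_i + (α L / 2) δ_i² for all i ≥ i₀, and δ_{i₀} ≤ λ/(2L). Then for every n ≥ 0, δ_{i₀ + n} ≤ (1 − (1/2) α λ)^n · δ_{i₀}; in particular δ_{i₀+n} ≤ λ/(2L) for all n. -/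
/-- Quantitative contraction inside the critical radius `λ/(2L)`:
if `δ_{i+1} ≤ (1 − (3/4)αλ) δ_i + (αL/2) δ_i²` for `i ≥ i₀` and `δ_{i₀} ≤ λ/(2L)`,
then `δ_{i₀+n} ≤ (1 − (1/2)αλ)ⁿ δ_{i₀}` and `δ_{i₀+n} ≤ λ/(2L)` for all `n`. -/
theorem contraction_in_critical_radius
    (α lam L : ℝ) (hα : 0 < α) (hlam : 0 < lam) (hL : 0 < L)
    (hαlam : α * lam ≤ 1) (i₀ : ℕ) (δ : ℕ → ℝ)
    (hnonneg : ∀ i, 0 ≤ δ i)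
    (hrec : ∀ i, i₀ ≤ i →
      δ (i + 1) ≤ (1 - (3 / 4) * α * lam) * δ i + (α * L / 2) * δ i ^ 2)
    (hinit : δ i₀ ≤ lam / (2 * L)) :
    ∀ n : ℕ, δ (i₀ + n) ≤ (1 - (1 / 2) * α * lam) ^ n * δ i₀ ∧
      δ (i₀ + n) ≤ lam / (2 * L) := by
  have hrate : 0 ≤ 1 - (1 / 2) * α * lam := by linarith
  have hαlam_pos : 0 < α * lam := mul_pos hα hlam
  have hstep : ∀ i, i₀ ≤ i → δ i ≤ lam / (2 * L) →
      δ (i + 1) ≤ (1 - (1 / 2) * α * lam) * δ i := by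
    intro i hi hδ
    have hLδ : δ i * (2 * L) ≤ lam := (le_div_iff₀ (by positivity)).mp hδ
    have hquad : α * δ i * (δ i * (2 * L)) ≤ α * δ i * lam :=
      mul_le_mul_of_nonneg_left hLδ (mul_nonneg hα.le (hnonneg i))
    linarith [hrec i hi]
  intro n
  induction n with
  | zero => simpa using hinit
  | succ n ih =>
    obtain ⟨hpow, hradius⟩ := ih
    have h := hstep (i₀ + n) (Nat.le_add_right _ _) hradius
    rw [← add_assoc]
    constructor
    · calc δ (i₀ + n + 1) ≤ (1 - (1 / 2) * α * lam) * δ (i₀ + n) := h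
        _ ≤ (1 - (1 / 2) * α * lam) * ((1 - (1 / 2) * α * lam) ^ n * δ i₀) :=
          mul_le_mul_of_nonneg_left hpow hrate
        _ = (1 - (1 / 2) * α * lam) ^ (n + 1) * δ i₀ := by ring
    · linarith [mul_nonneg hαlam_pos.le (hnonneg (i₀ + n))]
end
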